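/- Let G be a simple graph on a finite vertex set and let NM(G) = A·L be its neighbourhood matrix. Then six times the number of triangles of G (i.e., the number of 3-element cliques) equals ∑_i ∑_{j ∈ N(i)} (|NM(G)[j,j]| − NM(G)[i,j]), where the inner sum is over the neighbours j of i and |NM(G)[j,j]| = −NM(G)[j,j] is the absolute value of the diagonal entry. -/

import Mathlib

open SimpleGraph Matrix Finset

/-- The product `A * L` in terms of degrees and numbers of common neighbours. -/
lemma adjMatrix_mul_lapMatrix_apply {V : Type*} [Fintype V] [DecidableEq V]
    (G : SimpleGraph V) [DecidableRel G.Adj] (i j : V) :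
    (G.adjMatrix ℤ * G.lapMatrix ℤ) i j =
      (if G.Adj i j then (G.degree j : ℤ) else 0) -
        ((G.neighborFinset i ∩ G.neighborFinset j).card : ℤ) := by
  have hcard : G.neighborFinset i ∩ G.neighborFinset j =
      (G.neighborFinset i).filter fun k => G.Adj k j := by
    ext k
    simp [G.adj_comm]
  rw [lapMatrix, Matrix.mul_sub, Matrix.sub_apply, degMatrix, Matrix.mul_diagonal,
    adjMatrix_mul_apply, hcard]
  simp [adjMatrix_apply]

/-- Every triangle arises from exactly six ordered triples of vertices. -/
lemma six_mul_card_cliqueFinset_three {V : Type*} [Fintype V] [DecidableEq V]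
    (G : SimpleGraph V) [DecidableRel G.Adj] :
    6 * (G.cliqueFinset 3).card =
      ∑ i : V, ∑ j ∈ G.neighborFinset i,
        (G.neighborFinset i ∩ G.neighborFinset j).card := by
  let T : Finset (V × V × V) :=
    univ.filter fun t => G.Adj t.1 t.2.1 ∧ G.Adj t.1 t.2.2 ∧ G.Adj t.2.1 t.2.2
  have hT : T.card = ∑ i : V, ∑ j ∈ G.neighborFinset i,
      (G.neighborFinset i ∩ G.neighborFinset j).card := by
    simp only [T, card_filter, Fintype.sum_prod_type]
    refine sum_congr rfl fun i _ => ?_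
    rw [neighborFinset_eq_filter, sum_filter]
    refine sum_congr rfl fun j _ => ?_
    split_ifs with hij
    · rw [neighborFinset_eq_filter, ← filter_and, card_filter]
      simp [hij]
    · simp [hij]
  have hmaps : ∀ t ∈ T, ({t.1, t.2.1, t.2.2} : Finset V) ∈ G.cliqueFinset 3 := by
    intro t ht
    rw [mem_cliqueFinset_iff, is3Clique_triple_iff]
    simpa [T] using ht
  rw [← hT, card_eq_sum_card_fiberwise hmaps, mul_comm, ← smul_eq_mul, ← sum_const]
  refine sum_congr rfl fun s hs => ?_
  obtain ⟨a, b, c, hab, hac, hbc, rfl⟩ := is3Clique_iff.1 ((mem_cliqueFinset_iff).1 hs)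
  have hfib : (T.filter fun t => ({t.1, t.2.1, t.2.2} : Finset V) = {a, b, c}) =
      {(a, b, c), (a, c, b), (b, a, c), (b, c, a), (c, a, b), (c, b, a)} := by
    ext ⟨x, y, z⟩
    simp only [T, mem_filter, mem_univ, true_and, mem_insert, mem_singleton, Prod.mk.injEq]
    constructor
    · rintro ⟨⟨hxy, hxz, hyz⟩, h⟩
      have hx : x ∈ ({a, b, c} : Finset V) := by simp [← h]
      have hy : y ∈ ({a, b, c} : Finset V) := by simp [← h]
      have hz : z ∈ ({a, b, c} : Finset V) := by simp [← h]
      simp only [mem_insert, mem_singleton] at hx hy hz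
      have := hxy.ne
      have := hxz.ne
      have := hyz.ne
      grind
    · rintro (⟨rfl, rfl, rfl⟩ | ⟨rfl, rfl, rfl⟩ | ⟨rfl, rfl, rfl⟩ | ⟨rfl, rfl, rfl⟩ |
        ⟨rfl, rfl, rfl⟩ | ⟨rfl, rfl, rfl⟩) <;>
      exact ⟨by simp [hab, hac, hbc, hab.symm, hac.symm, hbc.symm], by grind⟩
  rw [hfib]
  simp [hab.ne, hac.ne, hbc.ne, hab.ne', hac.ne', hbc.ne']

theorem six_mul_triangle_count {V : Type*} [Fintype V] [DecidableEq V]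
    (G : SimpleGraph V) [DecidableRel G.Adj] :
    6 * ((G.cliqueFinset 3).card : ℤ) =
      ∑ i : V, ∑ j ∈ G.neighborFinset i,
        (|(G.adjMatrix ℤ * G.lapMatrix ℤ) j j| - (G.adjMatrix ℤ * G.lapMatrix ℤ) i j) := by
  have h := congrArg (Nat.cast : ℕ → ℤ) (six_mul_card_cliqueFinset_three G)
  push_cast at h
  rw [h]
  refine sum_congr rfl fun i _ => sum_congr rfl fun j hj => ?_
  rw [mem_neighborFinset] at hj
  rw [adjMatrix_mul_lapMatrix_apply, adjMatrix_mul_lapMatrix_apply]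
  simp [hj]
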